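/- Let M be an n×n homogeneous matrix of integers of degree d, and let R be the (n−1)×n matrix obtained by erasing one row of M. If a general hypersurface of degree d in P^r contains an arithmetically Cohen–Macaulay subscheme Z of codimension 2 having a degree Hilbert–Burch matrix equal to R, then a general form of degree d in C[x_0,...,x_r] is the determinant of a matrix of forms whose degree matrix is M. -/

import Mathlib

open MvPolynomial Matrix

/-- `f` is a form of degree `m : ℤ` -/
def IsFormOfDeg {k : ℕ} (f : MvPolynomial (Fin k) ℂ) (m : ℤ) : Prop :=
  if m < 0 then f = 0 else f.IsHomogeneous m.toNat

def HasDegMatrix {k a b : ℕ} (N : Matrix (Fin a) (Fin b) (MvPolynomial (Fin k) ℂ))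
    (M : Matrix (Fin a) (Fin b) ℤ) : Prop :=
  ∀ i j, IsFormOfDeg (N i j) (M i j)

def IsHomogMatrix {a b : ℕ} (M : Matrix (Fin a) (Fin b) ℤ) : Prop :=
  ∀ (i i' : Fin a) (j j' : Fin b), i < i' → j < j' →
    M i j + M i' j' = M i j' + M i' j

def WellOrderedMatrix {a b : ℕ} (M : Matrix (Fin a) (Fin b) ℤ) : Prop :=
  (∀ (i i' : Fin a) (j : Fin b), i ≤ i' → M i' j ≤ M i j) ∧
  (∀ (i : Fin a) (j j' : Fin b), j ≤ j' → M i j ≤ M i j')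

/-- A property `P` holds for a general form of degree `d` in `k` variables. -/
def GeneralForm (k : ℕ) (d : ℤ) (P : MvPolynomial (Fin k) ℂ → Prop) : Prop :=
  ∃ Φ : MvPolynomial ((Fin k) →₀ ℕ) ℂ,
    (∃ f : MvPolynomial (Fin k) ℂ, IsFormOfDeg f d ∧ eval f.coeff Φ ≠ 0) ∧
    ∀ f : MvPolynomial (Fin k) ℂ, IsFormOfDeg f d → eval f.coeff Φ ≠ 0 → P f

noncomputable def minorsIdeal {k n : ℕ} (A : Matrix (Fin n) (Fin (n+1)) (MvPolynomial (Fin k) ℂ)) :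
    Ideal (MvPolynomial (Fin k) ℂ) :=
  Ideal.span (Set.range fun j : Fin (n+1) => (A.submatrix id j.succAbove).det)

def IsZeroDimIdeal (I : Ideal (MvPolynomial (Fin 3) ℂ)) : Prop :=
  ringKrullDim (MvPolynomial (Fin 3) ℂ ⧸ I) = 1

noncomputable def hilbFn (I : Ideal (MvPolynomial (Fin 3) ℂ)) (t : ℕ) : ℕ :=
  Module.finrank ℂ (homogeneousSubmodule (Fin 3) ℂ t) -
    Module.finrank ℂ
      (Submodule.restrictScalars ℂ I ⊓ homogeneousSubmodule (Fin 3) ℂ t : Submodule ℂ _)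

noncomputable def hilbFnZ (I : Ideal (MvPolynomial (Fin 3) ℂ)) (t : ℤ) : ℕ :=
  if t < 0 then 0 else hilbFn I t.toNat

def Cond2 {n : ℕ} (M : Matrix (Fin n) (Fin n) ℤ) : Prop :=
  ∀ (t : ℕ) (_ : 1 ≤ t) (h2 : t < n),
    M ⟨t, h2⟩ ⟨t - 1, by omega⟩ < 0 →
      ((∑ i : Fin (n - t), M ⟨t + i.1, by have := i.2; omega⟩ ⟨t + i.1, by have := i.2; omega⟩) = 0
        ∨ (∑ i : Fin (n - t), M ⟨t + i.1, by have := i.2; omega⟩ ⟨t + i.1, by have := i.2; omega⟩)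
            = ∑ i, M i i)

/-- The affine cone over the subscheme of `ℙʳ` cut out by `I` has dimension `r - 1`,
i.e. the subscheme has codimension `2` in `ℙʳ`. -/
def IsCodimTwoIdeal (r : ℕ) (I : Ideal (MvPolynomial (Fin (r + 1)) ℂ)) : Prop :=
  ringKrullDim (MvPolynomial (Fin (r + 1)) ℂ ⧸ I) = (r - 1 : ℕ)

/-- The defining relation of a homogeneous matrix holds for all pairs of rows and columns. -/
theorem IsHomogMatrix.add_eq {a b : ℕ} {M : Matrix (Fin a) (Fin b) ℤ} (hM : IsHomogMatrix M)
    (i i' : Fin a) (j j' : Fin b) : M i j + M i' j' = M i j' + M i' j := by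
  rcases lt_trichotomy i i' with hi | rfl | hi
  · rcases lt_trichotomy j j' with hj | rfl | hj
    · exact hM i i' j j' hi hj
    · rfl
    · exact (hM i i' j' j hi hj).symm
  · ring
  · rcases lt_trichotomy j j' with hj | rfl | hj
    · linarith [hM i' i j j' hi hj]
    · rfl
    · linarith [hM i' i j' j hi hj]

theorem IsHomogMatrix.exists_eq_add {a b : ℕ} {M : Matrix (Fin (a + 1)) (Fin (b + 1)) ℤ}
    (hM : IsHomogMatrix M) : ∃ (u : Fin (a + 1) → ℤ) (v : Fin (b + 1) → ℤ),
      ∀ i j, M i j = u i + v j :=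
  ⟨fun i => M i 0, fun j => M 0 j - M 0 0, fun i j => by
    linarith [hM.add_eq i 0 j 0]⟩

theorem IsFormOfDeg.zero {k : ℕ} (m : ℤ) : IsFormOfDeg (0 : MvPolynomial (Fin k) ℂ) m := by
  unfold IsFormOfDeg
  split_ifs
  · rfl
  · exact isHomogeneous_zero _ _ _

theorem IsFormOfDeg.neg {k : ℕ} {f : MvPolynomial (Fin k) ℂ} {m : ℤ} (hf : IsFormOfDeg f m) :
    IsFormOfDeg (-f) m := by
  unfold IsFormOfDeg at *
  split_ifs at * with h
  · simp [hf]
  · exact hf.neg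

theorem IsFormOfDeg.sum {k : ℕ} {ι : Type*} (s : Finset ι) (f : ι → MvPolynomial (Fin k) ℂ)
    {m : ℤ} (hf : ∀ i ∈ s, IsFormOfDeg (f i) m) : IsFormOfDeg (∑ i ∈ s, f i) m := by
  unfold IsFormOfDeg at *
  split_ifs at * with h
  · exact Finset.sum_eq_zero hf
  · exact IsHomogeneous.sum _ _ _ hf

theorem IsFormOfDeg.prod {k : ℕ} {ι : Type*} (s : Finset ι) (f : ι → MvPolynomial (Fin k) ℂ)
    (m : ι → ℤ) (hf : ∀ i ∈ s, IsFormOfDeg (f i) (m i)) :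
    IsFormOfDeg (∏ i ∈ s, f i) (∑ i ∈ s, m i) := by
  by_cases hneg : ∃ i ∈ s, m i < 0
  · obtain ⟨i, hi, hlt⟩ := hneg
    have h0 := hf i hi
    rw [IsFormOfDeg, if_pos hlt] at h0
    rw [Finset.prod_eq_zero hi h0]
    exact IsFormOfDeg.zero _
  · push Not at hneg
    have hsum : ((∑ i ∈ s, (m i).toNat : ℕ) : ℤ) = ∑ i ∈ s, m i := by
      push_cast
      exact Finset.sum_congr rfl fun i hi => by simp [hneg i hi]
    rw [IsFormOfDeg, if_neg (not_lt.mpr (Finset.sum_nonneg hneg)), ← hsum, Int.toNat_natCast]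
    refine IsHomogeneous.prod s f _ fun i hi => ?_
    have h := hf i hi
    rwa [IsFormOfDeg, if_neg (not_lt.mpr (hneg i hi))] at h

/-- The determinant of a matrix of forms with degree matrix `(u i + v j)` is a form. -/
theorem HasDegMatrix.isFormOfDeg_det {k n : ℕ}
    {A : Matrix (Fin n) (Fin n) (MvPolynomial (Fin k) ℂ)} {u v : Fin n → ℤ}
    (hA : HasDegMatrix A (Matrix.of fun i j => u i + v j)) :
    IsFormOfDeg A.det (∑ i, u i + ∑ j, v j) := by
  rw [Matrix.det_apply]
  refine IsFormOfDeg.sum _ _ fun σ _ => ?_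
  have h : IsFormOfDeg (∏ i, A (σ i) i) (∑ i, u i + ∑ j, v j) := by
    rw [← Equiv.sum_comp σ u, ← Finset.sum_add_distrib]
    exact IsFormOfDeg.prod _ _ _ fun i _ => hA (σ i) i
  rcases Int.units_eq_one_or (Equiv.Perm.sign σ) with hs | hs
  · simpa [hs] using h
  · simpa [hs] using h.neg

/-- The form of degree `m : ℤ` in a polynomial, with value `0` in negative degrees. -/
noncomputable def formPart {k : ℕ} (m : ℤ) (f : MvPolynomial (Fin k) ℂ) :
    MvPolynomial (Fin k) ℂ :=
  if m < 0 then 0 else homogeneousComponent m.toNat f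

theorem isFormOfDeg_formPart {k : ℕ} (m : ℤ) (f : MvPolynomial (Fin k) ℂ) :
    IsFormOfDeg (formPart m f) m := by
  unfold IsFormOfDeg formPart
  split_ifs
  · rfl
  · exact homogeneousComponent_isHomogeneous _ _

theorem homogeneousComponent_mul_of_isFormOfDeg {k : ℕ} (d : ℕ) {m e : ℤ} (hme : m + e = d)
    (c : MvPolynomial (Fin k) ℂ) {g : MvPolynomial (Fin k) ℂ} (hg : IsFormOfDeg g e) :
    homogeneousComponent d (c * g) = formPart m c * g := by
  unfold IsFormOfDeg at hg
  split_ifs at hg with he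
  · simp [hg]
  let _ : GradedAlgebra (homogeneousSubmodule (Fin k) ℂ) := gradedAlgebra
  have hmem : g ∈ homogeneousSubmodule (Fin k) ℂ e.toNat := hg
  have hdec (i : ℕ) (f : MvPolynomial (Fin k) ℂ) :
      (DirectSum.decompose (homogeneousSubmodule (Fin k) ℂ) f i : MvPolynomial (Fin k) ℂ) =
        homogeneousComponent i f := decomposition.decompose'_apply f i
  rw [← hdec]
  unfold formPart
  split_ifs with hm
  · rw [DirectSum.coe_decompose_mul_of_right_mem_of_not_le _ hmem (by omega), zero_mul]
  · rw [DirectSum.coe_decompose_mul_of_right_mem_of_le _ hmem (by omega), hdec]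
    congr 3
    omega

/-- A form of degree `d = ∑ i, M i i` in the ideal of maximal minors of a matrix of forms, whose
degree matrix is the homogeneous matrix `M` with a row erased, is a determinant with degree
matrix `M`. -/
theorem exists_hasDegMatrix_det_eq_of_mem_minorsIdeal {k n : ℕ}
    {M : Matrix (Fin (n + 1)) (Fin (n + 1)) ℤ} (hM : IsHomogMatrix M) (q : Fin (n + 1))
    {A : Matrix (Fin n) (Fin (n + 1)) (MvPolynomial (Fin k) ℂ)}
    (hA : HasDegMatrix A (M.submatrix q.succAbove id)) {F : MvPolynomial (Fin k) ℂ}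
    (hF : IsFormOfDeg F (∑ i, M i i)) (hmem : F ∈ minorsIdeal A) :
    ∃ N : Matrix (Fin (n + 1)) (Fin (n + 1)) (MvPolynomial (Fin k) ℂ),
      HasDegMatrix N M ∧ N.det = F := by
  unfold IsFormOfDeg at hF
  split_ifs at hF with hd
  · subst hF
    exact ⟨0, fun i j => IsFormOfDeg.zero _, Matrix.det_zero⟩
  obtain ⟨u, v, huv⟩ := hM.exists_eq_add
  obtain ⟨c, hc⟩ := Ideal.mem_span_range_iff_exists_fun.mp hmem
  have hminor (j : Fin (n + 1)) : IsFormOfDeg (A.submatrix id j.succAbove).det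
      (∑ i, M i i - M q j) := by
    have h : IsFormOfDeg (A.submatrix id j.succAbove).det
        (∑ i, u (q.succAbove i) + ∑ i, v (j.succAbove i)) :=
      HasDegMatrix.isFormOfDeg_det fun i l => by
        simpa [huv] using hA i (j.succAbove l)
    convert h using 1
    simp only [huv, Finset.sum_add_distrib]
    rw [Fin.sum_univ_succAbove u q, Fin.sum_univ_succAbove v j]
    ring
  let row (j : Fin (n + 1)) : MvPolynomial (Fin k) ℂ :=
    (-1) ^ (q + j : ℕ) * formPart (M q j) (c j)
  have hrow (j : Fin (n + 1)) : IsFormOfDeg (row j) (M q j) := by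
    rcases neg_one_pow_eq_or (MvPolynomial (Fin k) ℂ) (q + j : ℕ) with hs | hs
    · simpa [row, hs] using isFormOfDeg_formPart (M q j) (c j)
    · simpa [row, hs] using (isFormOfDeg_formPart (M q j) (c j)).neg
  let N : Matrix (Fin (n + 1)) (Fin (n + 1)) (MvPolynomial (Fin k) ℂ) :=
    q.insertNth (α := fun _ => Fin (n + 1) → MvPolynomial (Fin k) ℂ) row A
  have hNq : N q = row :=
    Fin.insertNth_apply_same (α := fun _ => Fin (n + 1) → MvPolynomial (Fin k) ℂ) q row A
  have hNs (i : Fin n) : N (q.succAbove i) = A i :=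
    Fin.insertNth_apply_succAbove (α := fun _ => Fin (n + 1) → MvPolynomial (Fin k) ℂ) q row A i
  refine ⟨N, fun i j => ?_, ?_⟩
  · rcases Fin.eq_self_or_eq_succAbove q i with rfl | ⟨i, rfl⟩
    · rw [hNq]
      exact hrow j
    · rw [hNs]
      exact hA i j
  · have hsub (j : Fin (n + 1)) :
        N.submatrix q.succAbove j.succAbove = A.submatrix id j.succAbove := by
      ext1 i l
      simp [hNs]
    rw [Matrix.det_succ_row N q, ← homogeneousComponent_of_mem
      (n := (∑ i, M i i).toNat) (m := (∑ i, M i i).toNat) (p := F) hF |>.trans (if_pos rfl), ← hc,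
      map_sum]
    refine Finset.sum_congr rfl fun j _ => ?_
    rw [homogeneousComponent_mul_of_isFormOfDeg _ (m := M q j) (by omega) _ (hminor j), hsub,
      hNq, ← mul_assoc, ← mul_pow]
    simp

/-- If a general hypersurface of degree `d` in `ℙʳ` contains an arithmetically
Cohen–Macaulay codimension-2 subscheme with degree Hilbert–Burch matrix `R` (obtained
from the homogeneous matrix `M` by erasing one row), then a general form of degree `d`
is the determinant of a matrix of forms with degree matrix `M`.  (By Hilbert–Burch, such
a subscheme is encoded by an `n×(n+1)` matrix `A` of forms with degree matrix `R` whose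
maximal minors generate its saturated ideal and cut out a codimension-2 subscheme.) -/
theorem stmt_6 {n r : ℕ} (hr : 2 ≤ r)
    (M : Matrix (Fin (n + 1)) (Fin (n + 1)) ℤ) (hM : IsHomogMatrix M)
    (d : ℤ) (hd : d = ∑ i, M i i)
    (q : Fin (n + 1)) (R : Matrix (Fin n) (Fin (n + 1)) ℤ)
    (hR : R = M.submatrix q.succAbove id)
    (hyp : GeneralForm (r + 1) d (fun F =>
      ∃ A : Matrix (Fin n) (Fin (n + 1)) (MvPolynomial (Fin (r + 1)) ℂ),
        HasDegMatrix A R ∧ IsCodimTwoIdeal r (minorsIdeal A) ∧ F ∈ minorsIdeal A)) :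
    GeneralForm (r + 1) d (fun F =>
      ∃ N : Matrix (Fin (n + 1)) (Fin (n + 1)) (MvPolynomial (Fin (r + 1)) ℂ),
        HasDegMatrix N M ∧ N.det = F) := by
  subst hd hR
  obtain ⟨Φ, hne, hΦ⟩ := hyp
  refine ⟨Φ, hne, fun F hF hFΦ => ?_⟩
  obtain ⟨A, hA, -, hmem⟩ := hΦ F hF hFΦ
  exact exists_hasDegMatrix_det_eq_of_mem_minorsIdeal hM q hA hF hmem
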